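/- arXiv:2407.14450 — 4 statements merged into one kernel-verified Lean document; each statement's English description precedes it below -/
import Mathlib

section
/- Let O' ⊆ O be orders in an imaginary quadratic field K with O' = ℤ + fO for a positive integer f. Then: (1) O^× ∩ O' = (O')^×, i.e., every unit of O lying in the suborder O' is a unit of O'; and (2) the image of ℤ in O/fO intersected with (O/fO)^× equals (O'/fO)^×, the unit group of the subring O'/fO ⊆ O/fO (so the subgroup Δ = φ(ℤ) ∩ (O/fO)^× attached to Λ = ℤ equals (O'/fO)^×). -/
open scoped nonZeroDivisors

set_option synthInstance.maxHeartbeats 1000000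
set_option maxHeartbeats 1000000

noncomputable section

/-- `K` is an imaginary quadratic number field: degree 2 over `ℚ`, no real infinite places. -/
def IsImagQuadratic (K : Type*) [Field K] [NumberField K] : Prop :=
  Module.finrank ℚ K = 2 ∧ ∀ v : NumberField.InfinitePlace K, v.IsComplex

variable (K : Type*) [Field K]

section Defs

variable (R : Type*) [CommRing R] [Algebra R K] [IsFractionRing R K]

/-- `α ≡ β (mod 𝔪)`: whenever `α = a₁/a₂` and `β = b₁/b₂` with `a₁, a₂, b₁, b₂ ∈ R`,
one has `a₁ * b₂ - a₂ * b₁ ∈ 𝔪`. -/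
def CongMod (𝔪 : Ideal R) (α β : K) : Prop :=
  ∀ a₁ a₂ b₁ b₂ : R, a₂ ≠ 0 → b₂ ≠ 0 →
    α = algebraMap R K a₁ / algebraMap R K a₂ →
    β = algebraMap R K b₁ / algebraMap R K b₂ →
    a₁ * b₂ - a₂ * b₁ ∈ 𝔪

/-- `I_O(𝔪)`: the subgroup of the group of invertible fractional ideals generated by the
invertible integral ideals coprime with `𝔪`. -/
def IdealGroup (𝔪 : Ideal R) : Subgroup (FractionalIdeal R⁰ K)ˣ :=
  Subgroup.closure { I | ∃ 𝔞 : Ideal R, 𝔞 ⊔ 𝔪 = ⊤ ∧ (I : FractionalIdeal R⁰ K) = 𝔞 }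

/-- The defining set of `P_{O,Λ}(𝔪)`: principal fractional ideals `αO`, `α ∈ K^×`, with
`α ≡ λ (mod 𝔪)` for some `λ ∈ Λ` whose image in `O/𝔪` is a unit. -/
def PLamSet (𝔪 : Ideal R) (Λ : Set R) : Set (FractionalIdeal R⁰ K)ˣ :=
  { I | ∃ α : Kˣ, I = toPrincipalIdeal R K α ∧
      ∃ l ∈ Λ, IsUnit (Ideal.Quotient.mk 𝔪 l) ∧ CongMod K R 𝔪 (α : K) (algebraMap R K l) }

/-- The congruence subgroup `P_{O,Λ}(𝔪)` (the subgroup generated by its defining set;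
as a set it coincides with the defining set). -/
def PLam (𝔪 : Ideal R) (Λ : Set R) : Subgroup (FractionalIdeal R⁰ K)ˣ :=
  Subgroup.closure (PLamSet K R 𝔪 Λ)

/-- The generalized class group `cl_H = I_O(𝔪) / P_{O,Λ}(𝔪)`. -/
abbrev clH (𝔪 : Ideal R) (Λ : Set R) : Type _ :=
  IdealGroup K R 𝔪 ⧸ (PLam K R 𝔪 Λ).subgroupOf (IdealGroup K R 𝔪)

end Defs
/-- For `O' = ℤ + fO ⊆ O`: (1) `O^× ∩ O' = (O')^×`, and
(2) the image of `ℤ` in `O/fO` intersected with `(O/fO)^×` equals `(O'/fO)^×`, the unit group of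
the subring `O'/fO ⊆ O/fO` (embedded via the natural map on quotients). -/
theorem units_of_suborder_and_Delta_eq_units_of_subring
    [NumberField K] (hK : IsImagQuadratic K)
    (O O' : Subalgebra ℤ K)
    [Module.Free ℤ O] (hOrk : Module.finrank ℤ O = 2) [IsFractionRing O K]
    [Module.Free ℤ O'] (hO'rk : Module.finrank ℤ O' = 2) [IsFractionRing O' K]
    (hle : O' ≤ O) (f : ℕ) (hf : 0 < f)
    (hO' : ∀ x : K, x ∈ O' ↔ ∃ n : ℤ, ∃ y ∈ O, x = (n : K) + (f : K) * y) :
    ((∀ u : Oˣ, ∀ h : ((u : O) : K) ∈ O', IsUnit (⟨((u : O) : K), h⟩ : O')) ∧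
      (∀ u' : O'ˣ, IsUnit (Subalgebra.inclusion hle (u' : O')))) ∧
    (∀ x : O ⧸ Ideal.span {(f : O)},
      ((∃ n : ℤ, x = (n : O ⧸ Ideal.span {(f : O)})) ∧ IsUnit x) ↔
      (∃ y : O' ⧸ Ideal.comap (Subalgebra.inclusion hle) (Ideal.span {(f : O)}),
        IsUnit y ∧
          Ideal.quotientMap (Ideal.span {(f : O)})
            (Subalgebra.inclusion hle).toRingHom le_rfl y = x)) := by
  have hfin : Module.Finite ℤ O := Module.finite_of_finrank_pos (by rw [hOrk]; norm_num)
  have hintZ : (algebraMap ℤ O).IsIntegral :=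
    algebraMap_isIntegral_iff.mpr (Algebra.IsIntegral.of_finite ℤ O)
  have hint : (Subalgebra.inclusion hle).toRingHom.IsIntegral := by
    apply RingHom.IsIntegral.tower_top (algebraMap ℤ O')
    have : (Subalgebra.inclusion hle).toRingHom.comp (algebraMap ℤ O') = algebraMap ℤ O :=
      RingHom.ext_int _ _
    rw [this]
    exact hintZ
  have hloc : IsLocalHom (Subalgebra.inclusion hle).toRingHom :=
    hint.isLocalHom (Subalgebra.inclusion_injective hle)
  have hqloc : IsLocalHom (Ideal.quotientMap (I := Ideal.comap (Subalgebra.inclusion hle)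
      (Ideal.span {(f : O)})) (Ideal.span {(f : O)})
      (Subalgebra.inclusion hle).toRingHom le_rfl) := by
    apply RingHom.IsIntegral.isLocalHom
    · exact isIntegral_quotientMap_iff _ |>.mpr (RingHom.IsIntegral.trans _ _ hint
        (RingHom.isIntegral_of_surjective _ Ideal.Quotient.mk_surjective))
    · exact Ideal.quotientMap_injective
  refine ⟨⟨fun u h => ?_, fun u' => u'.isUnit.map _⟩, fun x => ⟨?_, ?_⟩⟩
  · apply hloc.map_nonunit
    exact u.isUnit
  · rintro ⟨⟨n, rfl⟩, hu⟩
    refine ⟨(n : O' ⧸ _), ?_, map_intCast _ n⟩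
    apply hqloc.map_nonunit
    rw [map_intCast]
    exact hu
  · rintro ⟨y, hy, rfl⟩
    refine ⟨?_, hy.map _⟩
    obtain ⟨w, rfl⟩ := Ideal.Quotient.mk_surjective y
    obtain ⟨n, z, hz, hw⟩ := (hO' w).mp w.2
    refine ⟨n, ?_⟩
    change Ideal.Quotient.mk (Ideal.span {(f : O)}) (Subalgebra.inclusion hle w) = _
    rw [← map_intCast (Ideal.Quotient.mk (Ideal.span {(f : O)})),
      Ideal.Quotient.eq, Ideal.mem_span_singleton]
    refine ⟨⟨z, hz⟩, Subtype.ext ?_⟩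
    change (w : K) - ((n : O) : K) = ((f : O) : K) * z
    rw [hw]
    push_cast
    ring
end
end

section
/- Let O be an order in an imaginary quadratic field K with O^× = {±1}, and let f be a prime number with f ≡ 1 (mod 4) such that fO is a prime ideal of O (f is inert in O). Let Λ = ℤ² = { n² : n ∈ ℤ } and H = P_{O,Λ}(fO). Then the generalized class group cl_H = I_O(fO)/P_{O,Λ}(fO) is finite of cardinality 2(f+1)·h(O), where h(O) is the cardinality of the class group cl_O. -/
open scoped nonZeroDivisors

set_option synthInstance.maxHeartbeats 1000000
set_option maxHeartbeats 1000000

noncomputable section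

/-- Every subgroup of the unit group of a commutative quotient ring is normal.
(Helper instance to speed up instance synthesis.) -/
instance unitsQuotNormal {R : Type*} [CommRing R] (𝔪 : Ideal R) (H : Subgroup (R ⧸ 𝔪)ˣ) :
    H.Normal :=
  Subgroup.normal_of_comm H

variable (K : Type*) [Field K]

section Helpers

open FractionalIdeal

set_option linter.unusedSectionVars false

/-- `R / fR` has `f ^ rank` elements. -/
lemma aux_card_quot (S : Type*) [CommRing S] [Module.Free ℤ S] [Module.Finite ℤ S] (f : ℕ) :
    Nat.card (S ⧸ Ideal.span {(f : S)}) = f ^ Module.finrank ℤ S := by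
  classical
  let b := Module.Free.chooseBasis ℤ S
  let φ : S →+ (Module.Free.ChooseBasisIndex ℤ S → ZMod f) :=
    { toFun := fun x i => ((b.repr x i : ℤ) : ZMod f)
      map_zero' := by ext; simp
      map_add' := by intros; ext; simp }
  have hφ : Function.Surjective φ := by
    intro g
    refine ⟨b.equivFun.symm (fun i => ((g i).cast : ℤ)), ?_⟩
    ext i
    have : b.repr (b.equivFun.symm (fun i => ((g i).cast : ℤ))) i = ((g i).cast : ℤ) := by
      rw [← Module.Basis.equivFun_apply, LinearEquiv.apply_symm_apply]
    change ((b.repr (b.equivFun.symm (fun i => ((g i).cast : ℤ))) i : ℤ) : ZMod f) = g i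
    rw [this, ZMod.intCast_zmod_cast]
  have hker : φ.ker = (Ideal.span {(f : S)}).toAddSubgroup := by
    ext x
    rw [AddMonoidHom.mem_ker]
    change _ ↔ x ∈ Ideal.span {(f : S)}
    rw [Ideal.mem_span_singleton']
    constructor
    · intro h
      have h' : ∀ i, (f : ℤ) ∣ b.repr x i := fun i => by
        have := congrFun h i
        exact (ZMod.intCast_zmod_eq_zero_iff_dvd _ _).1 this
      choose c hc using h'
      refine ⟨b.equivFun.symm c, ?_⟩
      apply b.equivFun.injective
      ext i
      have e : b.equivFun.symm c * (f : S) = (f : ℤ) • b.equivFun.symm c := by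
        rw [zsmul_eq_mul, mul_comm]; simp
      rw [e, map_zsmul, LinearEquiv.apply_symm_apply]
      simp [hc i]
    · rintro ⟨a, rfl⟩
      have e : a * (f : S) = (f : ℤ) • a := by
        rw [zsmul_eq_mul, mul_comm]; simp
      ext i
      change ((b.repr (a * (f : S)) i : ℤ) : ZMod f) = 0
      rw [e, map_zsmul]
      simp
  have h1 : Nat.card (S ⧸ Ideal.span {(f : S)}) = (Ideal.span {(f : S)}).toAddSubgroup.index := rfl
  rw [h1, ← hker, AddSubgroup.index_ker, AddMonoidHom.range_eq_top.2 hφ]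
  rw [Nat.card_congr (AddSubgroup.topEquiv (G := Module.Free.ChooseBasisIndex ℤ S → ZMod f)).toEquiv]
  rw [Nat.card_fun, Nat.card_zmod, Module.finrank_eq_card_chooseBasisIndex, Nat.card_eq_fintype_card]

variable {K}
variable {R : Type*} [CommRing R] [IsDomain R] [Algebra R K] [IsFractionRing R K]

lemma aux_mem_units_inv (J : (FractionalIdeal R⁰ K)ˣ) (x : K)
    (h : ∀ y ∈ (J : FractionalIdeal R⁰ K), x * y ∈ (1 : FractionalIdeal R⁰ K)) :
    x ∈ ((J⁻¹ : (FractionalIdeal R⁰ K)ˣ) : FractionalIdeal R⁰ K) := by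
  have h1 : spanSingleton R⁰ x * (J : FractionalIdeal R⁰ K) ≤ 1 := by
    rw [spanSingleton_mul_le_iff]; exact h
  have h2 : spanSingleton R⁰ x ≤ ((J⁻¹ : (FractionalIdeal R⁰ K)ˣ) : FractionalIdeal R⁰ K) := by
    calc spanSingleton R⁰ x = spanSingleton R⁰ x * (J : FractionalIdeal R⁰ K) * ((J⁻¹ : (FractionalIdeal R⁰ K)ˣ) : FractionalIdeal R⁰ K) := by
          rw [mul_assoc, Units.mul_inv, mul_one]
      _ ≤ 1 * _ := mul_le_mul_left h1 _
      _ = _ := one_mul _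
  exact spanSingleton_le_iff_mem.1 h2

/-- Every class is represented by an integral ideal not contained in a given proper ideal. -/
lemma aux_exists_coprime (𝔪 : Ideal R) (hm : 𝔪 ≠ ⊤) (J : (FractionalIdeal R⁰ K)ˣ) :
    ∃ x : Kˣ, ∃ 𝔞 : Ideal R, ¬ 𝔞 ≤ 𝔪 ∧
      ((toPrincipalIdeal R K x * J : (FractionalIdeal R⁰ K)ˣ) : FractionalIdeal R⁰ K) = 𝔞 := by
  have h1 : ∃ x ∈ ((J⁻¹ : (FractionalIdeal R⁰ K)ˣ) : FractionalIdeal R⁰ K),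
      ∃ y ∈ (J : FractionalIdeal R⁰ K), x * y ∉ (𝔪 : FractionalIdeal R⁰ K) := by
    by_contra! h
    have : ((J⁻¹ : (FractionalIdeal R⁰ K)ˣ) : FractionalIdeal R⁰ K) * J ≤ 𝔪 := by
      rw [FractionalIdeal.mul_le]; exact h
    rw [Units.inv_mul] at this
    have h1 := this (one_mem_one R⁰)
    obtain ⟨z, hz, hz1⟩ := (mem_coeIdeal R⁰).1 h1
    have : z = 1 := IsFractionRing.injective R K (by rw [hz1, map_one])
    subst this
    exact hm ((Ideal.eq_top_iff_one _).2 hz)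
  obtain ⟨x, hx, y, hy, hxy⟩ := h1
  have hx0 : x ≠ 0 := by
    rintro rfl
    rw [zero_mul] at hxy
    exact hxy (zero_mem _)
  have hle : spanSingleton R⁰ x * (J : FractionalIdeal R⁰ K) ≤ 1 := by
    rw [← Units.inv_mul J]
    exact mul_le_mul_left (spanSingleton_le_iff_mem.2 hx) _
  obtain ⟨𝔞, ha⟩ := le_one_iff_exists_coeIdeal.1 hle
  refine ⟨Units.mk0 x hx0, 𝔞, ?_, ?_⟩
  · intro hle'
    apply hxy
    have : x * y ∈ (𝔞 : FractionalIdeal R⁰ K) := by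
      rw [ha]; exact mul_mem_mul (mem_spanSingleton_self _ _) hy
    exact (coeIdeal_le_coeIdeal' R⁰ le_rfl).2 hle' this
  · rw [ha]; simp

/-- Finiteness of the class group of an order. -/
lemma aux_index_ne_zero [Module.Free ℤ R] [Module.Finite ℤ R] :
    (toPrincipalIdeal R K).range.index ≠ 0 := by
  classical
  let b := Module.Free.chooseBasis ℤ R
  let adm := AbsoluteValue.absIsAdmissible
  set M : R := algebraMap ℤ R (∏ m ∈ ClassGroup.finsetApprox b adm, m) with hMdef
  have hM : M ≠ 0 := ClassGroup.prod_finsetApprox_ne_zero b adm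
  have hfin : Finite {I : Ideal R // M ∈ I} := by
    have : Finite (R ⧸ Ideal.span {M}) :=
      Ideal.finiteQuotientOfFreeOfNeBot _ (by simpa using hM)
    have : Finite (Ideal (R ⧸ Ideal.span {M})) :=
      Finite.of_injective (fun I => (I : Set (R ⧸ Ideal.span {M}))) SetLike.coe_injective
    refine Finite.of_injective
      (fun I : {I : Ideal R // M ∈ I} => I.1.map (Ideal.Quotient.mk (Ideal.span {M}))) ?_
    rintro ⟨I, hI⟩ ⟨J, hJ⟩ h
    have e : ∀ I : Ideal R, M ∈ I →
        (I.map (Ideal.Quotient.mk (Ideal.span {M}))).comap (Ideal.Quotient.mk (Ideal.span {M})) = I := by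
      intro I hI
      rw [Ideal.comap_map_of_surjective _ Ideal.Quotient.mk_surjective]
      rw [← RingHom.ker_eq_comap_bot, Ideal.mk_ker]
      exact sup_eq_left.2 ((Ideal.span_singleton_le_iff_mem _).2 hI)
    have h' := congrArg (Ideal.comap (Ideal.Quotient.mk (Ideal.span {M}))) h
    simp only [e I hI, e J hJ] at h'
    exact Subtype.ext h'
  have key : ∀ J : (FractionalIdeal R⁰ K)ˣ, ∃ x : Kˣ, ∃ 𝔞 : {I : Ideal R // M ∈ I},
      ((toPrincipalIdeal R K x * J : (FractionalIdeal R⁰ K)ˣ) : FractionalIdeal R⁰ K) = 𝔞.1 := by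
    intro J
    obtain ⟨x, I, hI, hxI⟩ := aux_exists_coprime (⊥ : Ideal R) bot_ne_top J
    have hI0 : I ≠ ⊥ := fun h => hI h.le
    obtain ⟨c, hc, hc0, hmin⟩ := ClassGroup.exists_min (S := R) AbsoluteValue.abs
      ⟨I, mem_nonZeroDivisors_iff_ne_zero.2 hI0⟩
    have hdvd : ∀ a ∈ I, c ∣ M * a := by
      intro a ha
      obtain ⟨q, r, hr, hlt⟩ := ClassGroup.exists_mem_finset_approx' b adm a hc0
      have h0 := hmin _ (I.sub_mem (I.smul_of_tower_mem r ha) (I.mul_mem_left q hc)) hlt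
      obtain ⟨t, ht⟩ := Finset.dvd_prod_of_mem (fun m : ℤ => m) hr
      refine ⟨algebraMap ℤ R t * q, ?_⟩
      rw [hMdef, ht, map_mul]
      rw [sub_eq_zero, Algebra.smul_def] at h0
      linear_combination (algebraMap ℤ R t) * h0
    have hcK : algebraMap R K c ≠ 0 := by simpa using hc0
    have hMK : algebraMap R K M ≠ 0 := by simpa using hM
    let y : Kˣ := Units.mk0 (algebraMap R K M / algebraMap R K c) (div_ne_zero hMK hcK)
    have hle : spanSingleton R⁰ (algebraMap R K M / algebraMap R K c) * (I : FractionalIdeal R⁰ K) ≤ 1 := by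
      rw [spanSingleton_mul_le_iff]
      intro z hz
      obtain ⟨a, ha, rfl⟩ := (mem_coeIdeal R⁰).1 hz
      obtain ⟨d, hd⟩ := hdvd a ha
      refine (mem_one_iff R⁰).2 ⟨d, ?_⟩
      have := congrArg (algebraMap R K) hd
      simp only [map_mul] at this
      field_simp
      rw [this]; ring
    obtain ⟨𝔞, ha⟩ := le_one_iff_exists_coeIdeal.1 hle
    refine ⟨y * x, ⟨𝔞, ?_⟩, ?_⟩
    · have : algebraMap R K M ∈ (𝔞 : FractionalIdeal R⁰ K) := by
        rw [ha]
        have := mul_mem_mul (mem_spanSingleton_self R⁰ (algebraMap R K M / algebraMap R K c)) (mem_coeIdeal_of_mem (P := K) R⁰ hc)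
        rwa [div_mul_cancel₀ _ hcK] at this
      obtain ⟨m', hm', h⟩ := (mem_coeIdeal R⁰).1 this
      rwa [← IsFractionRing.injective R K h]
    · rw [map_mul, mul_assoc, Units.val_mul, hxI, ha]
      simp [y]
  choose x 𝔞 h using key
  have : Finite ((FractionalIdeal R⁰ K)ˣ ⧸ (toPrincipalIdeal R K).range) := by
    refine Finite.of_injective (fun q => 𝔞 q.out) ?_
    intro q q' hq
    simp only at hq
    have h1 := h q.out
    rw [hq, ← h q'.out] at h1
    have h2 := Units.ext h1
    rw [← q.out_eq', ← q'.out_eq']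
    apply QuotientGroup.eq.2
    refine ⟨x q.out * (x q'.out)⁻¹, ?_⟩
    rw [map_mul, map_inv, eq_mul_inv_of_mul_eq h2, mul_assoc (toPrincipalIdeal R K _),
      mul_inv_cancel_comm, mul_comm]
  exact Subgroup.index_ne_zero_of_finite


/-- The map from the localization at `𝔪` to `K`. -/
def auxJ (𝔪 : Ideal R) [𝔪.IsPrime] : Localization.AtPrime 𝔪 →+* K :=
  IsLocalization.lift (M := 𝔪.primeCompl) (g := algebraMap R K) (fun y => by
    rw [isUnit_iff_ne_zero, Ne, IsFractionRing.to_map_eq_zero_iff]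
    intro h
    exact y.2 (h ▸ 𝔪.zero_mem))

/-- The map from the localization at `𝔪` to the residue field. -/
def auxR (𝔪 : Ideal R) [h𝔪 : 𝔪.IsMaximal] : Localization.AtPrime 𝔪 →+* R ⧸ 𝔪 :=
  IsLocalization.lift (M := 𝔪.primeCompl) (g := Ideal.Quotient.mk 𝔪) (fun y => by
    let := Ideal.Quotient.field 𝔪
    rw [isUnit_iff_ne_zero, Ne, Ideal.Quotient.eq_zero_iff_mem]
    exact y.2)

lemma aux_isUnit_of_notMem (𝔪 : Ideal R) [h𝔪 : 𝔪.IsMaximal] {a : R} (ha : a ∉ 𝔪) :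
    IsUnit (Ideal.Quotient.mk 𝔪 a) := by
  let := Ideal.Quotient.field 𝔪
  rw [isUnit_iff_ne_zero, Ne, Ideal.Quotient.eq_zero_iff_mem]
  exact ha

lemma aux_notMem_of_isUnit (𝔪 : Ideal R) [h𝔪 : 𝔪.IsMaximal] {a : R}
    (ha : IsUnit (Ideal.Quotient.mk 𝔪 a)) : a ∉ 𝔪 := by
  let := Ideal.Quotient.field 𝔪
  rwa [isUnit_iff_ne_zero, Ne, Ideal.Quotient.eq_zero_iff_mem] at ha

lemma aux_unit_rep (𝔪 : Ideal R) [h𝔪 : 𝔪.IsMaximal] (u : (Localization.AtPrime 𝔪)ˣ) :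
    ∃ a b : R, a ∉ 𝔪 ∧ b ∉ 𝔪 ∧ auxJ (K := K) 𝔪 u * algebraMap R K b = algebraMap R K a ∧
      auxR 𝔪 u * Ideal.Quotient.mk 𝔪 b = Ideal.Quotient.mk 𝔪 a := by
  obtain ⟨⟨a, b⟩, h⟩ := IsLocalization.surj 𝔪.primeCompl (u : Localization.AtPrime 𝔪)
  simp only at h
  have h1 := congrArg (auxJ (K := K) 𝔪) h
  have h2 := congrArg (auxR 𝔪) h
  simp only [map_mul] at h1 h2
  rw [auxJ, IsLocalization.lift_eq, IsLocalization.lift_eq] at h1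
  rw [auxR, IsLocalization.lift_eq, IsLocalization.lift_eq] at h2
  refine ⟨a, b, ?_, b.2, h1, h2⟩
  apply aux_notMem_of_isUnit
  rw [← h2]
  exact (u.isUnit.map _).mul (aux_isUnit_of_notMem 𝔪 b.2)

lemma aux_rep_unit (𝔪 : Ideal R) [h𝔪 : 𝔪.IsMaximal] {a b : R} (ha : a ∉ 𝔪) (hb : b ∉ 𝔪) :
    ∃ u : (Localization.AtPrime 𝔪)ˣ,
      auxJ (K := K) 𝔪 u * algebraMap R K b = algebraMap R K a ∧
      auxR 𝔪 u * Ideal.Quotient.mk 𝔪 b = Ideal.Quotient.mk 𝔪 a := by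
  let ua := (IsLocalization.map_units (Localization.AtPrime 𝔪) (⟨a, ha⟩ : 𝔪.primeCompl)).unit
  let ub := (IsLocalization.map_units (Localization.AtPrime 𝔪) (⟨b, hb⟩ : 𝔪.primeCompl)).unit
  have h : ((ua * ub⁻¹ : (Localization.AtPrime 𝔪)ˣ) : Localization.AtPrime 𝔪) *
      algebraMap R _ b = algebraMap R _ a := by
    have e : algebraMap R (Localization.AtPrime 𝔪) b = ub := rfl
    rw [e, ← Units.val_mul, inv_mul_cancel_right]
    rfl
  refine ⟨ua * ub⁻¹, ?_, ?_⟩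
  · have h1 := congrArg (auxJ (K := K) 𝔪) h
    rw [map_mul] at h1
    rw [auxJ, IsLocalization.lift_eq, IsLocalization.lift_eq] at h1
    exact h1
  · have h1 := congrArg (auxR 𝔪) h
    rw [map_mul] at h1
    rw [auxR, IsLocalization.lift_eq, IsLocalization.lift_eq] at h1
    exact h1

/-- `u ↦ uR`. -/
def auxPhi (𝔪 : Ideal R) [h𝔪 : 𝔪.IsMaximal] :
    (Localization.AtPrime 𝔪)ˣ →* (FractionalIdeal R⁰ K)ˣ :=
  (toPrincipalIdeal R K).comp (Units.map (auxJ (K := K) 𝔪 : Localization.AtPrime 𝔪 →* K))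

lemma aux_coprime_of_not_le (𝔪 : Ideal R) [h𝔪 : 𝔪.IsMaximal] {𝔞 : Ideal R} (h : ¬ 𝔞 ≤ 𝔪) :
    𝔞 ⊔ 𝔪 = ⊤ :=
  h𝔪.out.2 _ (by
    refine lt_of_le_of_ne le_sup_right ?_
    intro e
    exact h (e ▸ le_sup_left))

lemma aux_mem_idealGroup (𝔪 : Ideal R) [h𝔪 : 𝔪.IsMaximal] {J : (FractionalIdeal R⁰ K)ˣ}
    (hJ : J ∈ IdealGroup K R 𝔪) :
    (∃ a ∉ 𝔪, algebraMap R K a ∈ (J : FractionalIdeal R⁰ K)) ∧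
    (∃ b ∉ 𝔪, algebraMap R K b ∈ ((J⁻¹ : (FractionalIdeal R⁰ K)ˣ) : FractionalIdeal R⁰ K)) := by
  have h1m : (1 : R) ∉ 𝔪 := fun h => h𝔪.ne_top ((Ideal.eq_top_iff_one _).2 h)
  induction hJ using Subgroup.closure_induction with
  | mem J hJ =>
    obtain ⟨𝔞, h, e⟩ := hJ
    constructor
    · have : ¬ 𝔞 ≤ 𝔪 := by
        intro hle
        rw [sup_eq_right.2 hle] at h
        exact h𝔪.ne_top h
      obtain ⟨a, ha, ham⟩ := SetLike.not_le_iff_exists.1 this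
      exact ⟨a, ham, by rw [e]; exact mem_coeIdeal_of_mem _ ha⟩
    · refine ⟨1, h1m, aux_mem_units_inv _ _ ?_⟩
      intro y hy
      rw [map_one, one_mul]
      rw [e] at hy
      exact coeIdeal_le_one hy
  | one =>
    refine ⟨⟨1, h1m, ?_⟩, ⟨1, h1m, ?_⟩⟩
    · rw [map_one, Units.val_one]; exact one_mem_one _
    · rw [map_one, inv_one, Units.val_one]; exact one_mem_one _
  | mul I J _ _ hI hJ =>
    obtain ⟨⟨a, ha, ha'⟩, ⟨b, hb, hb'⟩⟩ := hI
    obtain ⟨⟨c, hc, hc'⟩, ⟨d, hd, hd'⟩⟩ := hJ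
    refine ⟨⟨a * c, ?_, ?_⟩, ⟨b * d, ?_, ?_⟩⟩
    · exact fun h => (h𝔪.isPrime.mem_or_mem h).elim ha hc
    · rw [map_mul, Units.val_mul]; exact mul_mem_mul ha' hc'
    · exact fun h => (h𝔪.isPrime.mem_or_mem h).elim hb hd
    · rw [map_mul, mul_inv, Units.val_mul]; exact mul_mem_mul hb' hd'
  | inv J _ hJ =>
    refine ⟨hJ.2, ?_⟩
    rw [inv_inv]
    exact hJ.1

lemma aux_ne_zero_of_notMem {𝔪 : Ideal R} {a : R} (ha : a ∉ 𝔪) : algebraMap R K a ≠ 0 := by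
  rw [Ne, IsFractionRing.to_map_eq_zero_iff]
  rintro rfl
  exact ha 𝔪.zero_mem

lemma aux_principal_mem (𝔪 : Ideal R) [h𝔪 : 𝔪.IsMaximal] {a : R} (ha : a ∉ 𝔪) :
    toPrincipalIdeal R K (Units.mk0 (algebraMap R K a) (aux_ne_zero_of_notMem ha)) ∈
      IdealGroup K R 𝔪 := by
  apply Subgroup.subset_closure
  refine ⟨Ideal.span {a}, ?_, ?_⟩
  · apply aux_coprime_of_not_le
    rw [Ideal.span_singleton_le_iff_mem]
    exact ha
  · simp [coeIdeal_span_singleton]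

lemma aux_inf (𝔪 : Ideal R) [h𝔪 : 𝔪.IsMaximal] :
    IdealGroup K R 𝔪 ⊓ (toPrincipalIdeal R K).range = (auxPhi (K := K) 𝔪).range := by
  ext J
  constructor
  · rintro ⟨hJ, α, rfl⟩
    obtain ⟨⟨a, ha, ha'⟩, ⟨b, hb, hb'⟩⟩ := aux_mem_idealGroup 𝔪 hJ
    rw [← map_inv] at hb'
    rw [coe_toPrincipalIdeal, mem_spanSingleton] at ha' hb'
    obtain ⟨c, hc⟩ := ha'
    obtain ⟨d, hd⟩ := hb'
    rw [Algebra.smul_def] at hc hd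
    have hα : (α : K) ≠ 0 := α.ne_zero
    have hdα : algebraMap R K d = α * algebraMap R K b := by
      rw [← hd]; simp [mul_comm]
    have hcd : c * d = a * b := by
      apply IsFractionRing.injective R K
      rw [map_mul, map_mul, ← hc, hdα]; ring
    have hdm : d ∉ 𝔪 := by
      intro h
      have : a * b ∈ 𝔪 := hcd ▸ 𝔪.mul_mem_left c h
      exact (h𝔪.isPrime.mem_or_mem this).elim ha hb
    obtain ⟨u, hu, -⟩ := aux_rep_unit (K := K) 𝔪 hdm hb
    refine ⟨u, ?_⟩
    rw [auxPhi, MonoidHom.comp_apply]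
    congr 1
    ext
    have := hu.trans hdα
    exact mul_right_cancel₀ (aux_ne_zero_of_notMem hb) this
  · rintro ⟨u, rfl⟩
    refine ⟨?_, ⟨_, rfl⟩⟩
    obtain ⟨a, b, ha, hb, h, -⟩ := aux_unit_rep (K := K) 𝔪 u
    have : auxPhi (K := K) 𝔪 u =
      toPrincipalIdeal R K (Units.mk0 (algebraMap R K a) (aux_ne_zero_of_notMem ha)) *
      (toPrincipalIdeal R K (Units.mk0 (algebraMap R K b) (aux_ne_zero_of_notMem hb)))⁻¹ := by
      rw [eq_mul_inv_iff_mul_eq, auxPhi, MonoidHom.comp_apply, ← map_mul]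
      congr 1
      ext
      exact h
    rw [this]
    exact Subgroup.mul_mem _ (aux_principal_mem 𝔪 ha) (Subgroup.inv_mem _ (aux_principal_mem 𝔪 hb))

lemma aux_sup (𝔪 : Ideal R) [h𝔪 : 𝔪.IsMaximal] :
    IdealGroup K R 𝔪 ⊔ (toPrincipalIdeal R K).range = ⊤ := by
  rw [eq_top_iff]
  intro J _
  obtain ⟨x, 𝔞, h, e⟩ := aux_exists_coprime 𝔪 h𝔪.ne_top J
  have : J = (toPrincipalIdeal R K x * J) * (toPrincipalIdeal R K x)⁻¹ := by
    rw [mul_inv_cancel_comm]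
  rw [this]
  refine Subgroup.mul_mem_sup (Subgroup.subset_closure ⟨𝔞, aux_coprime_of_not_le 𝔪 h, e⟩) ?_
  exact Subgroup.inv_mem _ ⟨x, rfl⟩

/-- every element of `K` is a fraction with not both terms divisible by `p`. -/
lemma aux_rep [IsNoetherianRing R] {p : R} (hp0 : p ≠ 0) (hp : ¬ IsUnit p) (α : Kˣ) :
    ∃ a b : R, b ≠ 0 ∧ (α : K) = algebraMap R K a / algebraMap R K b ∧ ¬ (p ∣ a ∧ p ∣ b) := by
  obtain ⟨a, b, hb, h⟩ := IsFractionRing.div_surjective (A := R) (α : K)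
  have hb0 : b ≠ 0 := nonZeroDivisors.ne_zero hb
  obtain ⟨c, hc, hbc⟩ := (FiniteMultiplicity.of_not_isUnit hp hb0).exists_eq_pow_mul_and_not_dvd
  clear hb
  generalize multiplicity p b = n at hc
  induction n generalizing a b with
  | zero =>
    refine ⟨a, b, hb0, h.symm, ?_⟩
    rintro ⟨-, h2⟩
    rw [hc, pow_zero, one_mul] at h2
    exact hbc h2
  | succ n ih =>
    by_cases ha : p ∣ a
    · obtain ⟨a', rfl⟩ := ha
      have hc' : b = p * (p ^ n * c) := by rw [hc]; ring
      have hp0' : algebraMap R K p ≠ 0 := by simpa using hp0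
      refine ih a' (p ^ n * c) ?_ ?_ rfl
      · rw [← h, hc', map_mul _ p, map_mul _ p, mul_div_mul_left _ _ hp0']
      · rintro e
        rw [e, mul_zero] at hc'
        exact hb0 hc'
    · exact ⟨a, b, hb0, h.symm, fun h => ha h.1⟩

lemma aux_PLam [IsNoetherianRing R] {p : R} (hp0 : p ≠ 0) (𝔪 : Ideal R)
    (h𝔪def : 𝔪 = Ideal.span {p}) [h𝔪 : 𝔪.IsMaximal]
    (Λ : Set R) (S : Subgroup (R ⧸ 𝔪)ˣ)
    (hS : ∀ u : (R ⧸ 𝔪)ˣ, u ∈ S ↔ ∃ l ∈ Λ, (u : R ⧸ 𝔪) = Ideal.Quotient.mk _ l) :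
    PLam K R 𝔪 Λ = (S.comap (Units.map (auxR 𝔪 : _ →* R ⧸ 𝔪))).map (auxPhi (K := K) 𝔪) := by
  have hprime := h𝔪.isPrime
  suffices h : PLamSet K R 𝔪 Λ = ((S.comap (Units.map (auxR 𝔪 : _ →* R ⧸ 𝔪))).map
        (auxPhi (K := K) 𝔪) : Set (FractionalIdeal R⁰ K)ˣ) by
    rw [PLam, h, Subgroup.closure_eq]
  ext J
  constructor
  · rintro ⟨α, rfl, l, hl, hlu, hcong⟩
    have hpu : ¬ IsUnit p := by
      intro h
      exact h𝔪.ne_top (h𝔪def ▸ Ideal.span_singleton_eq_top.2 h)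
    obtain ⟨a, b, hb0, hab, hnd⟩ := aux_rep (K := K) hp0 hpu α
    have h1 := hcong a b l 1 hb0 one_ne_zero hab (by simp)
    rw [mul_one] at h1
    have hlm := aux_notMem_of_isUnit 𝔪 hlu
    have hbm : b ∉ 𝔪 := by
      intro hbm
      have ham : a ∈ 𝔪 := by
        have := 𝔪.add_mem h1 (𝔪.mul_mem_right l hbm)
        rwa [sub_add_cancel] at this
      rw [h𝔪def] at ham hbm
      exact hnd ⟨Ideal.mem_span_singleton.1 ham, Ideal.mem_span_singleton.1 hbm⟩
    have ham : a ∉ 𝔪 := by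
      intro ham
      have : b * l ∈ 𝔪 := by
        have := 𝔪.sub_mem ham h1
        rwa [sub_sub_cancel] at this
      exact (hprime.mem_or_mem this).elim hbm hlm
    obtain ⟨u, hu1, hu2⟩ := aux_rep_unit (K := K) 𝔪 ham hbm
    refine ⟨u, ?_, ?_⟩
    · change _ ∈ S
      rw [hS]
      refine ⟨l, hl, ?_⟩
      apply (aux_isUnit_of_notMem 𝔪 hbm).mul_right_cancel
      change auxR 𝔪 u * _ = _
      rw [hu2, ← map_mul, Ideal.Quotient.eq, mul_comm l b]
      exact h1
    · rw [auxPhi, MonoidHom.comp_apply]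
      congr 1
      ext
      change auxJ 𝔪 (u : Localization.AtPrime 𝔪) = (α : K)
      rw [hab, eq_div_iff (aux_ne_zero_of_notMem hbm), hu1]
  · rintro ⟨u, hu, rfl⟩
    have hu' : Units.map (auxR 𝔪 : _ →* R ⧸ 𝔪) u ∈ S := hu
    rw [hS] at hu'
    obtain ⟨l, hl, e⟩ := hu'
    have e' : auxR 𝔪 u = Ideal.Quotient.mk 𝔪 l := e
    refine ⟨Units.map (auxJ (K := K) 𝔪 : Localization.AtPrime 𝔪 →* K) u, rfl, l, hl, ?_, ?_⟩
    · rw [← e']; exact u.isUnit.map _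
    · obtain ⟨a, b, ha, hb, h1, h2⟩ := aux_unit_rep (K := K) 𝔪 u
      intro a₁ a₂ b₁ b₂ ha₂ hb₂ hα hβ
      have hα' : auxJ (K := K) 𝔪 u = algebraMap R K a₁ / algebraMap R K a₂ := hα
      have ha₂' : algebraMap R K a₂ ≠ 0 := by simpa using ha₂
      have hb₂' : algebraMap R K b₂ ≠ 0 := by simpa using hb₂
      rw [eq_div_iff hb₂', ← map_mul] at hβ
      have hβ' := IsFractionRing.injective R K hβ
      rw [hα', div_mul_eq_mul_div, div_eq_iff ha₂', ← map_mul, ← map_mul] at h1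
      have h1' := IsFractionRing.injective R K h1
      rw [e', ← map_mul, Ideal.Quotient.eq] at h2
      have h3 : b * (a₁ * b₂ - a₂ * b₁) ∈ 𝔪 := by
        have : b * (a₁ * b₂ - a₂ * b₁) = -(a₂ * b₂) * (l * b - a) := by
          linear_combination b₂ * h1' + a₂ * b * hβ'
        rw [this]
        exact 𝔪.mul_mem_left _ h2
      exact (hprime.mem_or_mem h3).resolve_left hb

lemma aux_ker (𝔪 : Ideal R) [h𝔪 : 𝔪.IsMaximal] (hu : ∀ u : Rˣ, u = 1 ∨ u = -1)
    {v : (Localization.AtPrime 𝔪)ˣ} (hv : v ∈ (auxPhi (K := K) 𝔪).ker) :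
    auxR 𝔪 v = 1 ∨ auxR 𝔪 v = -1 := by
  rw [MonoidHom.mem_ker, auxPhi, MonoidHom.comp_apply] at hv
  have h1 : spanSingleton R⁰ (auxJ (K := K) 𝔪 v) = 1 := by
    have := congrArg Units.val hv
    rw [coe_toPrincipalIdeal] at this
    exact this
  set w := Units.map (auxJ (K := K) 𝔪 : Localization.AtPrime 𝔪 →* K) v with hw
  have h2 : spanSingleton R⁰ ((w⁻¹ : Kˣ) : K) = 1 := by
    have := congrArg Units.val (congrArg (fun x => x⁻¹) hv)
    rw [← map_inv, coe_toPrincipalIdeal, inv_one] at this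
    exact this
  have h3 : ((w : Kˣ) : K) ∈ (1 : FractionalIdeal R⁰ K) := by
    rw [← h1]; exact mem_spanSingleton_self _ _
  have h4 : ((w⁻¹ : Kˣ) : K) ∈ (1 : FractionalIdeal R⁰ K) := by
    rw [← h2]; exact mem_spanSingleton_self _ _
  obtain ⟨x, hx⟩ := (mem_one_iff _).1 h3
  obtain ⟨y, hy⟩ := (mem_one_iff _).1 h4
  have hxy : x * y = 1 := by
    apply IsFractionRing.injective R K
    rw [map_mul, hx, hy, map_one, Units.mul_inv]
  obtain ⟨a, b, ha, hb, h5, h6⟩ := aux_unit_rep (K := K) 𝔪 v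
  have hx' : auxJ (K := K) 𝔪 v = algebraMap R K x := hx.symm
  rw [hx', ← map_mul] at h5
  have h7 := IsFractionRing.injective R K h5
  rw [← h7, map_mul] at h6
  have h8 := (aux_isUnit_of_notMem 𝔪 hb).mul_right_cancel h6
  rw [h8]
  rcases hu (Units.mkOfMulEqOne x y hxy) with h | h
  · left
    have : x = 1 := congrArg Units.val h
    rw [this, map_one]
  · right
    have : x = -1 := congrArg Units.val h
    rw [this, map_neg, map_one]

lemma aux_main [IsNoetherianRing R] {p : R} (hp0 : p ≠ 0) (𝔪 : Ideal R)
    (h𝔪def : 𝔪 = Ideal.span {p}) [h𝔪 : 𝔪.IsMaximal]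
    (hu : ∀ u : Rˣ, u = 1 ∨ u = -1) (Λ : Set R) (S : Subgroup (R ⧸ 𝔪)ˣ)
    (hS : ∀ u : (R ⧸ 𝔪)ˣ, u ∈ S ↔ ∃ l ∈ Λ, (u : R ⧸ 𝔪) = Ideal.Quotient.mk _ l)
    (hneg : -1 ∈ S) :
    (PLam K R 𝔪 Λ).relIndex (IdealGroup K R 𝔪) =
      S.index * (toPrincipalIdeal R K).range.index := by
  have hP := aux_PLam (K := K) hp0 𝔪 h𝔪def Λ S hS
  have hle : PLam K R 𝔪 Λ ≤ (auxPhi (K := K) 𝔪).range := by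
    rw [hP]; exact Subgroup.map_le_range _ _
  have hle2 : (auxPhi (K := K) 𝔪).range ≤ IdealGroup K R 𝔪 := by
    rw [← aux_inf]; exact inf_le_left
  rw [← Subgroup.relIndex_mul_relIndex _ _ _ hle hle2]
  congr 1
  · rw [hP, MonoidHom.range_eq_map, Subgroup.relIndex_map_map, top_sup_eq,
      Subgroup.relIndex_top_right, sup_eq_left.2, Subgroup.index_comap_of_surjective]
    · intro x
      obtain ⟨a, ha⟩ := Ideal.Quotient.mk_surjective (x : R ⧸ 𝔪)
      have ham : a ∉ 𝔪 := aux_notMem_of_isUnit 𝔪 (by rw [ha]; exact x.isUnit)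
      have h1m : (1 : R) ∉ 𝔪 := fun h => h𝔪.ne_top ((Ideal.eq_top_iff_one _).2 h)
      obtain ⟨u, -, hu⟩ := aux_rep_unit (K := K) 𝔪 ham h1m
      refine ⟨u, ?_⟩
      ext
      rw [map_one, mul_one, ha] at hu
      exact hu
    · intro v hv
      change _ ∈ S
      rcases aux_ker (K := K) 𝔪 hu hv with h | h
      · have : Units.map (auxR 𝔪 : _ →* R ⧸ 𝔪) v = 1 := Units.ext h
        rw [this]; exact one_mem _
      · have : Units.map (auxR 𝔪 : _ →* R ⧸ 𝔪) v = -1 := Units.ext h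
        rw [this]; exact hneg
  · rw [← aux_inf, Subgroup.inf_relIndex_left, ← Subgroup.relIndex_sup_right, aux_sup,
      Subgroup.relIndex_top_right]

/-- The squares of the prime field. -/
lemma aux_squares (S : Type*) [CommRing S] [IsDomain S] [Module.Free ℤ S] [Module.Finite ℤ S]
    (hrk : Module.finrank ℤ S = 2) (f : ℕ) (hf : f.Prime) (hf4 : f % 4 = 1)
    [h𝔪 : (Ideal.span {(f : S)}).IsMaximal] :
    ∃ T : Subgroup (S ⧸ Ideal.span {(f : S)})ˣ,
      (∀ u : (S ⧸ Ideal.span {(f : S)})ˣ, u ∈ T ↔ ∃ l ∈ { x : S | ∃ n : ℤ, x = (n : S) ^ 2 },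
        (u : S ⧸ Ideal.span {(f : S)}) = Ideal.Quotient.mk _ l) ∧ -1 ∈ T ∧
      T.index = 2 * (f + 1) := by
  classical
  have hcard := aux_card_quot S f
  rw [hrk] at hcard
  set 𝔪 := Ideal.span {(f : S)} with h𝔪def
  let : Field (S ⧸ 𝔪) := Ideal.Quotient.field 𝔪
  have : Fact f.Prime := ⟨hf⟩
  have : CharP (S ⧸ 𝔪) f := by
    have h0 : (f : S ⧸ 𝔪) = 0 := by
      have : Ideal.Quotient.mk 𝔪 (f : S) = 0 :=
        Ideal.Quotient.eq_zero_iff_mem.2 (Ideal.mem_span_singleton_self _)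
      rwa [map_natCast] at this
    exact (CharP.charP_iff_prime_eq_zero hf).2 h0
  let i : ZMod f →+* S ⧸ 𝔪 := ZMod.castHom dvd_rfl _
  let iu : (ZMod f)ˣ →* (S ⧸ 𝔪)ˣ := Units.map (i : ZMod f →* S ⧸ 𝔪)
  have hiu : Function.Injective iu := Units.map_injective i.injective
  let Q : Subgroup (ZMod f)ˣ := (powMonoidHom 2).range
  refine ⟨Q.map iu, ?_, ?_, ?_⟩
  · intro u
    constructor
    · rintro ⟨_, ⟨z, rfl⟩, rfl⟩
      refine ⟨_, ⟨((z : ZMod f).cast : ℤ), rfl⟩, ?_⟩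
      have hz : i (z : ZMod f) = (((z : ZMod f).cast : ℤ) : S ⧸ 𝔪) := by
        conv_lhs => rw [← ZMod.intCast_zmod_cast (z : ZMod f)]
        rw [map_intCast]
      rw [map_pow, map_intCast, ← hz, ← map_pow]
      rfl
    · rintro ⟨_, ⟨n, rfl⟩, h⟩
      rw [map_pow, map_intCast] at h
      have hn : (n : ZMod f) ≠ 0 := by
        intro hn
        have : ((n : ℤ) : S ⧸ 𝔪) = i (n : ZMod f) := by rw [map_intCast]
        rw [this, hn, map_zero] at h
        exact u.ne_zero (by rw [h]; simp)
      refine ⟨_, ⟨Units.mk0 _ hn, rfl⟩, ?_⟩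
      ext
      rw [h]
      change i ((n : ZMod f) ^ 2) = _
      rw [map_pow, map_intCast]
  · obtain ⟨z, hz⟩ := (ZMod.exists_sq_eq_neg_one_iff (p := f)).2 (by omega)
    have hz0 : z ≠ 0 := by rintro rfl; simp at hz
    refine ⟨_, ⟨Units.mk0 z hz0, rfl⟩, ?_⟩
    ext
    change i (z ^ 2) = -1
    rw [sq, ← hz, map_neg, map_one]
  · have h1 : Nat.card Q = (f - 1) / 2 := by
      have := IsCyclic.card_powMonoidHom_range (G := (ZMod f)ˣ) 2
      rw [Nat.card_units, Nat.card_zmod] at this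
      rw [this, Nat.gcd_eq_right (by omega)]
    have h2 : Nat.card (Q.map iu) = (f - 1) / 2 := by
      rw [← h1]
      exact Nat.card_congr (Q.equivMapOfInjective iu hiu).symm.toEquiv
    have h3 := (Q.map iu).index_mul_card
    rw [h2, Nat.card_units, hcard] at h3
    obtain ⟨k, rfl⟩ : ∃ k, f = 4 * k + 1 := ⟨f / 4, by omega⟩
    have hk : 0 < k := by
      rcases Nat.eq_zero_or_pos k with rfl | h
      · exact absurd hf (by norm_num)
      · exact h
    have e1 : (4 * k + 1 - 1) / 2 = 2 * k := by omega
    have e2 : (4 * k + 1) ^ 2 - 1 = (2 * (4 * k + 1 + 1)) * (2 * k) := by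
      have : (4 * k + 1) ^ 2 = (2 * (4 * k + 1 + 1)) * (2 * k) + 1 := by ring
      omega
    rw [e1, e2] at h3
    exact Nat.eq_of_mul_eq_mul_right (by omega) h3

end Helpers

/-- Let `O` be an order with `O^× = {±1}` in an imaginary quadratic field, let
`f ≡ 1 (mod 4)` be a prime number that is inert in `O` (i.e. `fO` is a prime ideal), and let
`Λ = ℤ² = {n² : n ∈ ℤ}`. Then `cl_H = I_O(fO)/P_{O,Λ}(fO)` is finite of cardinality
`2(f+1)·h(O)`. -/
theorem clH_card_of_squares
    [NumberField K] (hK : IsImagQuadratic K)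
    (O : Subalgebra ℤ K) [Module.Free ℤ O] (hOrk : Module.finrank ℤ O = 2)
    [IsFractionRing O K]
    (hu : ∀ u : Oˣ, u = 1 ∨ u = -1)
    (f : ℕ) (hf : f.Prime) (hf4 : f % 4 = 1)
    (hinert : (Ideal.span {(f : O)} : Ideal O).IsPrime) :
    Finite (clH K O (Ideal.span {(f : O)}) { x : O | ∃ n : ℤ, x = (n : O) ^ 2 }) ∧
    Nat.card (clH K O (Ideal.span {(f : O)}) { x : O | ∃ n : ℤ, x = (n : O) ^ 2 })
      = 2 * (f + 1) * Nat.card (ClassGroup O) := by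
  have hfinO : Module.Finite ℤ O := Module.finite_of_finrank_pos (by omega)
  have : IsNoetherianRing O := IsNoetherianRing.of_finite ℤ O
  have hf0 : (f : O) ≠ 0 := by
    intro h
    have : ((f : O) : K) = 0 := by rw [h]; rfl
    have h2 : (f : K) = 0 := by simpa using this
    exact hf.ne_zero (by exact_mod_cast h2)
  have hmax : (Ideal.span {(f : O)} : Ideal O).IsMaximal := by
    have : Finite (O ⧸ (Ideal.span {(f : O)} : Ideal O)) :=
      Ideal.finiteQuotientOfFreeOfNeBot _ (by simpa using hf0)
    exact Ideal.Quotient.maximal_of_isField _ (Finite.isField_of_domain _)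
  obtain ⟨T, hT, hneg, hidx⟩ := aux_squares O hOrk f hf hf4
  have hmain := aux_main (K := K) hf0 _ rfl hu _ T hT hneg
  rw [hidx] at hmain
  have hcl : Nat.card (ClassGroup O) = (toPrincipalIdeal O K).range.index :=
    Nat.card_congr (ClassGroup.equiv (R := O) K).toEquiv
  have hne := aux_index_ne_zero (K := K) (R := O)
  rw [← hcl] at hmain hne
  have hc : Nat.card (clH K O (Ideal.span {(f : O)}) { x : O | ∃ n : ℤ, x = (n : O) ^ 2 })
      = 2 * (f + 1) * Nat.card (ClassGroup O) := hmain
  refine ⟨Nat.finite_of_card_ne_zero ?_, hc⟩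
  rw [hc]
  positivity
end
end

section
/- Let O' ⊆ O be orders in an imaginary quadratic field K with O' = ℤ + fO for a positive integer f. Then the map 𝔞 ↦ 𝔞O is a bijection from the set of invertible integral O'-ideals coprime with fO' to the set of invertible integral O-ideals coprime with fO, with inverse 𝔟 ↦ 𝔟 ∩ O'; moreover this bijection is multiplicative (𝔞𝔠 ↦ (𝔞O)(𝔠O)) and norm-preserving, i.e., #(O'/𝔞) = #(O/𝔞O). -/
open scoped nonZeroDivisors

set_option synthInstance.maxHeartbeats 1000000
set_option maxHeartbeats 1000000

noncomputable section


section Helpers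

lemma aux_inv_iff {R F : Type*} [CommRing R] [IsDomain R] [Field F] [Algebra R F]
    [IsFractionRing R F] (a : Ideal R) :
    (∃ I : (FractionalIdeal R⁰ F)ˣ, (I : FractionalIdeal R⁰ F) = a) ↔
      ∃ (c : Ideal R) (d : R), d ≠ 0 ∧ a * c = Ideal.span {d} := by
  constructor
  · rintro ⟨I, hI⟩
    obtain ⟨d, c, hd, hc⟩ := FractionalIdeal.exists_eq_spanSingleton_mul
      ((I⁻¹ : (FractionalIdeal R⁰ F)ˣ) : FractionalIdeal R⁰ F)
    have h1 : (I : FractionalIdeal R⁰ F) * ((I⁻¹ : (FractionalIdeal R⁰ F)ˣ) : FractionalIdeal R⁰ F) = 1 :=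
      I.mul_inv
    have hd' : algebraMap R F d ≠ 0 := by
      simpa using hd
    refine ⟨c, d, hd, ?_⟩
    apply FractionalIdeal.coeIdeal_injective (R := R) (K := F)
    beta_reduce
    rw [FractionalIdeal.coeIdeal_mul, FractionalIdeal.coeIdeal_span_singleton]
    rw [hI, hc] at h1
    have h2 : FractionalIdeal.spanSingleton R⁰ (algebraMap R F d) *
        FractionalIdeal.spanSingleton R⁰ (algebraMap R F d)⁻¹ = 1 := by
      rw [FractionalIdeal.spanSingleton_mul_spanSingleton, mul_inv_cancel₀ hd',
        FractionalIdeal.spanSingleton_one]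
    calc (a : FractionalIdeal R⁰ F) * c
        = (FractionalIdeal.spanSingleton R⁰ (algebraMap R F d) *
        FractionalIdeal.spanSingleton R⁰ (algebraMap R F d)⁻¹) * (a * c) := by rw [h2, one_mul]
      _ = FractionalIdeal.spanSingleton R⁰ (algebraMap R F d) *
        (a * (FractionalIdeal.spanSingleton R⁰ (algebraMap R F d)⁻¹ * c)) := by ring
      _ = _ := by rw [h1, mul_one]
  · rintro ⟨c, d, hd, h⟩
    have hd' : algebraMap R F d ≠ 0 := by
      simpa using hd
    have h1 : (a : FractionalIdeal R⁰ F) *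
        (c * FractionalIdeal.spanSingleton R⁰ (algebraMap R F d)⁻¹) = 1 := by
      rw [← mul_assoc, ← FractionalIdeal.coeIdeal_mul, h,
        FractionalIdeal.coeIdeal_span_singleton,
        FractionalIdeal.spanSingleton_mul_spanSingleton, mul_inv_cancel₀ hd',
        FractionalIdeal.spanSingleton_one]
    exact ⟨Units.mkOfMulEqOne _ _ h1, rfl⟩

variable {A B : Type*} [CommRing A] [CommRing B] (φ : A →ₐ[ℤ] B)
  (f : ℕ)

lemma aux_cop {R : Type*} [CommRing R] {a : Ideal R} {f : R} (h : a ⊔ Ideal.span {f} = ⊤) :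
    ∃ u ∈ a, ∃ v, u + f * v = 1 := by
  have h1 : (1 : R) ∈ a ⊔ Ideal.span {f} := by rw [h]; trivial
  obtain ⟨u, hu, w, hw, e⟩ := Submodule.mem_sup.1 h1
  obtain ⟨v, rfl⟩ := Ideal.mem_span_singleton'.1 hw
  exact ⟨u, hu, v, by rw [← e]; ring⟩

lemma aux_cop' {R : Type*} [CommRing R] {a : Ideal R} {f : R} {u v : R} (hu : u ∈ a)
    (h : u + f * v = 1) : a ⊔ Ideal.span {f} = ⊤ := by
  rw [Ideal.eq_top_iff_one, ← h]
  exact Submodule.add_mem_sup hu (Ideal.mul_mem_right _ _ (Ideal.mem_span_singleton_self f))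

lemma aux_map_cop {a : Ideal A} (h : a ⊔ Ideal.span {(f : A)} = ⊤) :
    Ideal.map φ a ⊔ Ideal.span {(f : B)} = ⊤ := by
  obtain ⟨u, hu, v, e⟩ := aux_cop h
  exact aux_cop' (u := φ u) (v := φ v) (Ideal.mem_map_of_mem φ hu) (by simpa using congrArg φ e)


lemma aux_f_mul (hc : ∀ y : B, ∃ x : A, φ x = f * y)
    {a : Ideal A} {x : B} (hx : x ∈ Ideal.map φ a) :
    ∃ z ∈ a, φ z = f * x := by
  suffices H : ∀ r : B, ∃ z ∈ a, φ z = f * r * x by simpa using H 1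
  refine Submodule.span_induction (p := fun x _ => ∀ r : B, ∃ z ∈ a, φ z = f * r * x) ?_ ?_ ?_ ?_
    (show x ∈ Submodule.span B (φ '' a) from hx)
  · rintro _ ⟨y, hy, rfl⟩ r
    obtain ⟨w, hw⟩ := hc r
    exact ⟨w * y, a.mul_mem_left _ hy, by rw [map_mul, hw]⟩
  · intro r
    exact ⟨0, a.zero_mem, by simp⟩
  · intro x y _ _ h1 h2 r
    obtain ⟨z, hz, e⟩ := h1 r
    obtain ⟨w, hw, e'⟩ := h2 r
    exact ⟨z + w, a.add_mem hz hw, by rw [map_add, e, e']; ring⟩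
  · intro s x _ h1 r
    obtain ⟨z, hz, e⟩ := h1 (r * s)
    exact ⟨z, hz, by rw [e, smul_eq_mul]; ring⟩

lemma aux_comap_map (hc : ∀ y : B, ∃ x : A, φ x = f * y) (hinj : Function.Injective φ)
    {a : Ideal A} (h : a ⊔ Ideal.span {(f : A)} = ⊤) :
    Ideal.comap φ (Ideal.map φ a) = a := by
  refine le_antisymm ?_ Ideal.le_comap_map
  intro x hx
  obtain ⟨u, hu, v, e⟩ := aux_cop h
  obtain ⟨z, hz, e'⟩ := aux_f_mul φ f hc (Ideal.mem_comap.1 hx)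
  have hz' : z = f * x := hinj (by simpa using e')
  have : x = u * x + v * z := by
    rw [hz']; linear_combination (-x) * e
  rw [this]
  exact a.add_mem (a.mul_mem_right _ hu) (a.mul_mem_left _ hz)

lemma aux_comap_cop (hc : ∀ y : B, ∃ x : A, φ x = f * y) (hinj : Function.Injective φ)
    {b : Ideal B} (h : b ⊔ Ideal.span {(f : B)} = ⊤) :
    Ideal.comap φ b ⊔ Ideal.span {(f : A)} = ⊤ := by
  obtain ⟨u, hu, v, e⟩ := aux_cop h
  obtain ⟨w, hw⟩ := hc v
  obtain ⟨t, ht⟩ := hc (v ^ 2)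
  have hu' : u = 1 - f * v := by linear_combination e
  refine aux_cop' (u := (1 - w) * (1 + w)) (v := t) ?_ ?_
  · rw [Ideal.mem_comap, map_mul]
    apply b.mul_mem_right
    rw [map_sub, map_one, hw, ← hu']
    exact hu
  · apply hinj
    simp only [map_add, map_mul, map_sub, map_one, map_natCast, hw, ht]
    ring

lemma aux_map_comap (hc : ∀ y : B, ∃ x : A, φ x = f * y) (hinj : Function.Injective φ)
    {b : Ideal B} (h : b ⊔ Ideal.span {(f : B)} = ⊤) :
    Ideal.map φ (Ideal.comap φ b) = b := by
  refine le_antisymm Ideal.map_comap_le ?_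
  intro x hx
  obtain ⟨u, hu, v, e⟩ := aux_cop (aux_comap_cop φ f hc hinj h)
  obtain ⟨w, hw⟩ := hc x
  have e' : φ u + f * φ v = 1 := by simpa using congrArg φ e
  have : x = φ u * x + φ v * φ w := by
    rw [hw]; linear_combination (-x) * e'
  rw [this]
  refine Ideal.add_mem _ (Ideal.mul_mem_right _ _ (Ideal.mem_map_of_mem φ hu))
    (Ideal.mul_mem_left _ _ (Ideal.mem_map_of_mem φ ?_))
  rw [Ideal.mem_comap, hw]
  exact b.mul_mem_left _ hx

lemma aux_map_inv (hinj : Function.Injective φ) {a : Ideal A}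
    (h : ∃ (c : Ideal A) (d : A), d ≠ 0 ∧ a * c = Ideal.span {d}) :
    ∃ (c : Ideal B) (d : B), d ≠ 0 ∧ Ideal.map φ a * c = Ideal.span {d} := by
  obtain ⟨c, d, hd, e⟩ := h
  refine ⟨Ideal.map φ c, φ d, (map_ne_zero_iff φ hinj).2 hd, ?_⟩
  rw [← Ideal.map_mul, e, Ideal.map_span, Set.image_singleton]

lemma aux_comap_inv [IsDomain B] (hf : (f : B) ≠ 0)
    (hc : ∀ y : B, ∃ x : A, φ x = f * y) (hinj : Function.Injective φ)
    {b : Ideal B} (hb : b ⊔ Ideal.span {(f : B)} = ⊤)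
    (h : ∃ (c : Ideal B) (d : B), d ≠ 0 ∧ b * c = Ideal.span {d}) :
    ∃ (c : Ideal A) (d : A), d ≠ 0 ∧ Ideal.comap φ b * c = Ideal.span {d} := by
  obtain ⟨c, d, hd, e⟩ := h
  obtain ⟨D, hD⟩ := hc d
  let c' : Ideal A := (Ideal.span {D} : Ideal A).colon (Ideal.comap φ b : Set A)
  have hc' : ∀ x, x ∈ c' ↔ ∀ y ∈ Ideal.comap φ b, x * y ∈ Ideal.span {D} := by
    intro x
    simp [c', Submodule.mem_colon]
  refine ⟨c', D, ?_, le_antisymm ?_ ?_⟩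
  · rintro rfl
    rw [map_zero] at hD
    exact mul_ne_zero hf hd hD.symm
  · rw [Ideal.mul_le]
    intro r hr s hs
    rw [mul_comm]
    exact (hc' s).1 hs r hr
  · rw [Ideal.span_singleton_le_iff_mem]
    obtain ⟨u, hu, v, e1⟩ := aux_cop (aux_comap_cop φ f hc hinj hb)
    have hDc : D ∈ c' := (hc' D).2 fun y _ =>
      Ideal.mul_mem_right _ _ (Ideal.mem_span_singleton_self D)
    -- every element of `b * c` times `f ^ 3` comes from the product
    have key : ∀ x ∈ b * c, ∃ z ∈ Ideal.comap φ b * c', φ z = f ^ 3 * x := by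
      intro x hx
      refine Submodule.mul_induction_on hx ?_ ?_
      · intro m hm n hn
        obtain ⟨p, hp⟩ := hc m
        obtain ⟨q, hq⟩ := hc n
        refine ⟨p * (f * q), Ideal.mul_mem_mul ?_ ?_, ?_⟩
        · rw [Ideal.mem_comap, hp]
          exact b.mul_mem_left _ hm
        · rw [hc']
          intro y hy
          have h1 : φ y * n ∈ Ideal.span {d} := by
            rw [← e]; exact Ideal.mul_mem_mul hy hn
          obtain ⟨r, hr⟩ := Ideal.mem_span_singleton'.1 h1
          obtain ⟨s, hs⟩ := hc r
          rw [Ideal.mem_span_singleton']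
          refine ⟨s, hinj ?_⟩
          simp only [map_mul, map_natCast, hs, hD, hq]
          linear_combination (f : B) ^ 2 * hr
        · simp only [map_mul, map_natCast, hp, hq]
          ring
      · rintro x y ⟨z, hz, ez⟩ ⟨w, hw, ew⟩
        exact ⟨z + w, Ideal.add_mem _ hz hw, by rw [map_add, ez, ew]; ring⟩
    obtain ⟨z, hz, ez⟩ := key d (by rw [e]; exact Ideal.mem_span_singleton_self d)
    have hz' : z = f ^ 2 * D := hinj (by simp only [map_mul, map_pow, map_natCast, hD, ez]; ring)
    have : D = (u * (1 + f * v)) * D + v ^ 2 * z := by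
      rw [hz']
      linear_combination (-D * (1 + f * v)) * e1
    rw [this]
    exact Ideal.add_mem _ (Ideal.mul_mem_mul (Ideal.mul_mem_right _ _ hu) hDc)
      (Ideal.mul_mem_left _ _ hz)

lemma aux_card (hc : ∀ y : B, ∃ x : A, φ x = f * y) (hinj : Function.Injective φ)
    {a : Ideal A} (h : a ⊔ Ideal.span {(f : A)} = ⊤) :
    Nat.card (A ⧸ a) = Nat.card (B ⧸ Ideal.map φ a) := by
  have hle : a ≤ Ideal.comap (φ : A →+* B) (Ideal.map φ a) := Ideal.le_comap_map
  refine Nat.card_eq_of_bijective (Ideal.quotientMap (Ideal.map φ a) (φ : A →+* B) hle) ⟨?_, ?_⟩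
  · exact Ideal.quotientMap_injective' (le_of_eq (aux_comap_map φ f hc hinj h))
  · intro x
    obtain ⟨x, rfl⟩ := Ideal.Quotient.mk_surjective x
    obtain ⟨u, hu, v, e⟩ := aux_cop h
    obtain ⟨w, hw⟩ := hc x
    refine ⟨Ideal.Quotient.mk _ (v * w), ?_⟩
    rw [Ideal.quotientMap_mk, eq_comm, Ideal.Quotient.eq]
    have e' : φ u + f * φ v = 1 := by simpa using congrArg φ e
    have : x - (φ : A →+* B) (v * w) = φ u * x := by
      simp only [RingHom.coe_coe, map_mul, hw]
      linear_combination (-x) * e'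
    rw [this]
    exact Ideal.mul_mem_right _ _ (Ideal.mem_map_of_mem φ hu)

end Helpers

variable (K : Type*) [Field K]

/-- For `O' = ℤ + fO ⊆ O`, the map `𝔞 ↦ 𝔞O` is a bijection from invertible
integral `O'`-ideals coprime with `fO'` to invertible integral `O`-ideals coprime with `fO`,
with inverse `𝔟 ↦ 𝔟 ∩ O'`; it is multiplicative and norm-preserving. -/
theorem ideal_extension_bijOn_coprime
    [NumberField K] (hK : IsImagQuadratic K)
    (O O' : Subalgebra ℤ K)
    [Module.Free ℤ O] (hOrk : Module.finrank ℤ O = 2) [IsFractionRing O K]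
    [Module.Free ℤ O'] (hO'rk : Module.finrank ℤ O' = 2) [IsFractionRing O' K]
    (hle : O' ≤ O) (f : ℕ) (hf : 0 < f)
    (hO' : ∀ x : K, x ∈ O' ↔ ∃ n : ℤ, ∃ y ∈ O, x = (n : K) + (f : K) * y) :
    Set.BijOn (fun 𝔞 : Ideal O' => Ideal.map (Subalgebra.inclusion hle) 𝔞)
      { 𝔞 : Ideal O' | (∃ I : (FractionalIdeal O'⁰ K)ˣ,
            (I : FractionalIdeal O'⁰ K) = 𝔞) ∧ 𝔞 ⊔ Ideal.span {(f : O')} = ⊤ }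
      { 𝔟 : Ideal O | (∃ J : (FractionalIdeal O⁰ K)ˣ,
            (J : FractionalIdeal O⁰ K) = 𝔟) ∧ 𝔟 ⊔ Ideal.span {(f : O)} = ⊤ } ∧
    (∀ 𝔞 : Ideal O', ((∃ I : (FractionalIdeal O'⁰ K)ˣ,
            (I : FractionalIdeal O'⁰ K) = 𝔞) ∧ 𝔞 ⊔ Ideal.span {(f : O')} = ⊤) →
        Ideal.comap (Subalgebra.inclusion hle) (Ideal.map (Subalgebra.inclusion hle) 𝔞) = 𝔞) ∧
    (∀ 𝔟 : Ideal O, ((∃ J : (FractionalIdeal O⁰ K)ˣ,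
            (J : FractionalIdeal O⁰ K) = 𝔟) ∧ 𝔟 ⊔ Ideal.span {(f : O)} = ⊤) →
        Ideal.map (Subalgebra.inclusion hle) (Ideal.comap (Subalgebra.inclusion hle) 𝔟) = 𝔟) ∧
    (∀ 𝔞 𝔠 : Ideal O',
        Ideal.map (Subalgebra.inclusion hle) (𝔞 * 𝔠)
          = Ideal.map (Subalgebra.inclusion hle) 𝔞 * Ideal.map (Subalgebra.inclusion hle) 𝔠) ∧
    (∀ 𝔞 : Ideal O', ((∃ I : (FractionalIdeal O'⁰ K)ˣ,
            (I : FractionalIdeal O'⁰ K) = 𝔞) ∧ 𝔞 ⊔ Ideal.span {(f : O')} = ⊤) →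
        Nat.card (O' ⧸ 𝔞) = Nat.card (O ⧸ Ideal.map (Subalgebra.inclusion hle) 𝔞)) := by
  have hinj : Function.Injective (Subalgebra.inclusion hle) := Subalgebra.inclusion_injective hle
  have hc : ∀ y : O, ∃ x : O', Subalgebra.inclusion hle x = f * y := by
    intro y
    refine ⟨⟨(f : K) * y, (hO' _).2 ⟨0, y, y.2, by simp⟩⟩, ?_⟩
    apply Subtype.ext
    simp
  have hf0 : (f : O) ≠ 0 := Nat.cast_ne_zero.2 hf.ne'
  refine ⟨⟨?_, ?_, ?_⟩, ?_, ?_, ?_, ?_⟩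
  · rintro a ⟨h1, h2⟩
    exact ⟨(aux_inv_iff _).2 (aux_map_inv _ hinj ((aux_inv_iff _).1 h1)), aux_map_cop _ f h2⟩
  · rintro a ⟨_, h2⟩ c ⟨_, h4⟩ h
    rw [← aux_comap_map _ f hc hinj h2, ← aux_comap_map _ f hc hinj h4]
    exact congrArg (Ideal.comap (Subalgebra.inclusion hle)) h
  · rintro b ⟨h1, h2⟩
    exact ⟨Ideal.comap (Subalgebra.inclusion hle) b,
      ⟨(aux_inv_iff _).2 (aux_comap_inv _ f hf0 hc hinj h2 ((aux_inv_iff _).1 h1)),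
        aux_comap_cop _ f hc hinj h2⟩, aux_map_comap _ f hc hinj h2⟩
  · rintro a ⟨_, h2⟩
    exact aux_comap_map _ f hc hinj h2
  · rintro b ⟨_, h2⟩
    exact aux_map_comap _ f hc hinj h2
  · intro a c
    exact Ideal.map_mul _ a c
  · rintro a ⟨_, h2⟩
    exact aux_card _ f hc hinj h2
end
end

section
/- Let O be an order in an imaginary quadratic field K, let σ : K → K be the nontrivial field automorphism of K over ℚ (complex conjugation), and note that σ(O) = O. Then for every invertible (equivalently, proper) nonzero ideal 𝔪 ⊆ O one has 𝔪 · σ(𝔪) = N(𝔪)·O, where N(𝔪) = #(O/𝔪) is the norm of 𝔪. -/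
open scoped nonZeroDivisors

set_option synthInstance.maxHeartbeats 1000000
set_option maxHeartbeats 1000000

noncomputable section

variable (K : Type*) [Field K]

section Helpers
variable {K}

lemma aux_fixed_rat [NumberField K] (h2 : Module.finrank ℚ K = 2)
    (σ : K ≃ₐ[ℚ] K) (hσ : σ ≠ (AlgEquiv.refl : K ≃ₐ[ℚ] K)) (x : K) (hx : σ x = x) :
    ∃ q : ℚ, algebraMap ℚ K q = x := by
  have := IntermediateField.isSimpleOrder_of_finrank_prime ℚ K (by rw [h2]; exact Nat.prime_two)
  have hmem : x ∈ IntermediateField.fixedField (Subgroup.zpowers σ) := by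
    rintro ⟨m, hm⟩
    have : Subgroup.zpowers σ ≤ MulAction.stabilizer (K ≃ₐ[ℚ] K) x := by
      rw [Subgroup.zpowers_le]; exact hx
    exact this hm
  rcases this.eq_bot_or_eq_top (IntermediateField.fixedField (Subgroup.zpowers σ)) with h | h
  · rw [h] at hmem
    exact IntermediateField.mem_bot.1 hmem
  · exfalso
    apply hσ
    ext y
    have hy : y ∈ IntermediateField.fixedField (Subgroup.zpowers σ) := by rw [h]; trivial
    exact hy ⟨σ, Subgroup.mem_zpowers σ⟩

lemma aux_invol [NumberField K] (h2 : Module.finrank ℚ K = 2)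
    (σ : K ≃ₐ[ℚ] K) (hσ : σ ≠ (AlgEquiv.refl : K ≃ₐ[ℚ] K)) (x : K) : σ (σ x) = x := by
  have h1 : Fintype.card (K ≃ₐ[ℚ] K) ≤ 2 := h2 ▸ AlgEquiv.card_le
  have h3 : orderOf σ ≤ 2 := orderOf_le_card_univ.trans h1
  have h4 : 0 < orderOf σ := orderOf_pos σ
  have h5 : orderOf σ ≠ 1 := by
    rw [Ne, orderOf_eq_one_iff]; exact hσ
  have h6 : orderOf σ = 2 := by omega
  have h7 := pow_orderOf_eq_one σ
  rw [h6, pow_two] at h7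
  exact DFunLike.congr_fun h7 x

lemma aux_int [NumberField K] (h2 : Module.finrank ℚ K = 2)
    (σ : K ≃ₐ[ℚ] K) (hσ : σ ≠ (AlgEquiv.refl : K ≃ₐ[ℚ] K)) (x : K) (hx : σ x = x)
    (hi : IsIntegral ℤ x) : ∃ n : ℤ, (n : K) = x := by
  obtain ⟨q, rfl⟩ := aux_fixed_rat h2 σ hσ x hx
  have : IsIntegral ℤ q := (isIntegral_algebraMap_iff (algebraMap ℚ K).injective).1 hi
  obtain ⟨n, rfl⟩ := IsIntegrallyClosed.isIntegral_iff.1 this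
  exact ⟨n, by simp⟩

lemma aux_gcd (A B C : ℤ) (hA : A ≠ 0) : ∃ g A' B' C' u v w : ℤ, g ≠ 0 ∧ A = g * A' ∧ B = g * B' ∧
    C = g * C' ∧ u * A' + v * B' + w * C' = 1 := by
  obtain ⟨g, hg⟩ := (IsPrincipalIdealRing.principal (Ideal.span {A, B, C})).principal
  have hm : ∀ x ∈ ({A, B, C} : Set ℤ), ∃ y, x = g * y := by
    intro x hx
    have : x ∈ Ideal.span {A, B, C} := Ideal.subset_span hx
    rw [hg] at this
    exact Ideal.mem_span_singleton.1 this
  obtain ⟨A', hA'⟩ := hm A (by simp)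
  obtain ⟨B', hB'⟩ := hm B (by simp)
  obtain ⟨C', hC'⟩ := hm C (by simp)
  have hgm : g ∈ Ideal.span {A, B, C} := by rw [hg]; exact Submodule.mem_span_singleton_self g
  obtain ⟨u, z, hz, h1⟩ := Ideal.mem_span_insert.1 hgm
  obtain ⟨v, w, h3⟩ := Ideal.mem_span_pair.1 hz
  have hg0 : g ≠ 0 := by rintro rfl; simp at hA'; exact hA hA'
  refine ⟨g, A', B', C', u, v, w, hg0, hA', hB', hC', mul_left_cancel₀ hg0 ?_⟩
  rw [← h3, hA', hB', hC'] at h1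
  linarith

/-- `O ⊆ ℤ + ℤ θ`. -/
lemma aux_coord (α β a b x y g A B C u v w p q r s : K) (hα : a ≠ 0) (hβ : β ≠ 0)
    (hg : g ≠ 0) (hD : α * b - a * β ≠ 0)
    (hA : α * a = g * A) (hB : α * b + a * β = g * B) (hC : β * b = g * C)
    (h1 : u * A + v * B + w * C = 1)
    (hx1 : x * α = p * α + q * β) (hx2 : x * β = r * α + s * β)
    (hy1 : y * a = p * a + q * b) (hy2 : y * b = r * a + s * b) :
    x = p + (u * q + v * (s - p) - w * r) * (a * β / g) := by
  have ht : x + y = p + s := by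
    apply mul_right_cancel₀ hD
    linear_combination b * hx1 - a * hx2 - β * hy1 + α * hy2
  have hb : a * β ≠ 0 := mul_ne_zero hα hβ
  have eA : (x - p) * g * A = q * (a * β) := by
    linear_combination (-(x - p)) * hA + a * hx1
  have eB : (x - p) * g * B = (s - p) * (a * β) := by
    linear_combination (-(x - p)) * hB + b * hx1 - β * hy1 + a * β * ht
  have eC : (x - p) * g * C = - r * (a * β) := by
    linear_combination (-(x - p)) * hC + β * b * ht - β * hy2
  field_simp
  linear_combination (-(x - p) * g) * h1 + u * eA + v * eB + w * eC

end Helpers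

/-- For every invertible (= proper) nonzero ideal `𝔪` of an order `O` in an
imaginary quadratic field `K`, one has `𝔪 · σ(𝔪) = N(𝔪) · O`, where `σ` is complex conjugation
(the nontrivial automorphism of `K/ℚ`, which preserves `O`, restricting to `σO` on `O`) and
`N(𝔪) = #(O/𝔪)`. -/
theorem mul_conj_eq_norm_smul
    [NumberField K] (hK : IsImagQuadratic K)
    (O : Subalgebra ℤ K) [Module.Free ℤ O] (hOrk : Module.finrank ℤ O = 2)
    [IsFractionRing O K]
    (σ : K ≃ₐ[ℚ] K) (hσ : σ ≠ (AlgEquiv.refl : K ≃ₐ[ℚ] K))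
    (σO : O ≃+* O) (hσO : ∀ x : O, ((σO x : O) : K) = σ (x : K))
    (𝔪 : Ideal O) (h𝔪 : 𝔪 ≠ ⊥)
    (hinv : ∃ I : (FractionalIdeal O⁰ K)ˣ, (I : FractionalIdeal O⁰ K) = 𝔪) :
    𝔪 * Ideal.map σO 𝔪 = Ideal.span {(Nat.card (O ⧸ 𝔪) : O)} := by
  obtain ⟨h2, -⟩ := hK
  have hfin : Module.Finite ℤ O := Module.finite_of_finrank_pos (by omega)
  have hIntegral : ∀ x : O, IsIntegral ℤ (x : K) := fun x =>
    (Algebra.IsIntegral.isIntegral (R := ℤ) x).map O.val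
  have hinvol := aux_invol h2 σ hσ
  have hσint : ∀ n : ℤ, σ (n : K) = n := fun n => map_intCast σ n
  let e : Module.Basis (Fin 2) ℤ O := Module.finBasisOfFinrankEq ℤ O hOrk
  let f : Module.Basis (Fin 2) ℤ 𝔪 := 𝔪.selfBasis e h𝔪
  have hcard : ((e.det (fun i => ((f i : 𝔪) : O))).natAbs) = Nat.card (O ⧸ 𝔪) :=
    Submodule.natAbs_det_basis_change e (𝔪.restrictScalars ℤ) f
  -- coordinates in `O`
  have hcoord : ∀ x : O, ∃ p q : ℤ, p = e.repr x 0 ∧ q = e.repr x 1 ∧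
      (x : K) = p * (e 0 : K) + q * (e 1 : K) := by
    intro x
    refine ⟨_, _, rfl, rfl, ?_⟩
    have := congrArg (Subtype.val) (e.sum_repr x)
    simpa [Fin.sum_univ_two] using this.symm
  have hfcoord : ∀ x ∈ 𝔪, ∃ p q : ℤ,
      (x : K) = p * ((f 0 : O) : K) + q * ((f 1 : O) : K) := by
    intro x hx
    refine ⟨f.repr ⟨x, hx⟩ 0, f.repr ⟨x, hx⟩ 1, ?_⟩
    have := congrArg (fun z : 𝔪 => ((z : O) : K)) (f.sum_repr ⟨x, hx⟩)
    rw [Fin.sum_univ_two] at this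
    simpa [-Module.Basis.sum_repr] using this.symm
  have hdet : ∀ v : Fin 2 → O, (v 0 : K) * σ (v 1) - σ (v 0) * v 1 =
      (e.det v : ℤ) * ((e 0 : K) * σ (e 1) - σ (e 0) * e 1) := by
    intro v
    obtain ⟨p, q, hp, hq, h⟩ := hcoord (v 0)
    obtain ⟨r, s, hr, hs, h'⟩ := hcoord (v 1)
    rw [Module.Basis.det_apply, Matrix.det_fin_two]
    simp only [Module.Basis.toMatrix_apply, ← hp, ← hq, ← hr, ← hs]
    rw [h, h']
    simp only [map_add, map_mul, hσint]
    push_cast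
    ring
  set α : K := ((f 0 : O) : K) with hαdef
  set β : K := ((f 1 : O) : K) with hβdef
  set D0 : K := (e 0 : K) * σ (e 1) - σ (e 0) * e 1 with hD0
  have hαm : (f 0 : O) ∈ 𝔪 := (f 0).2
  have hβm : (f 1 : O) ∈ 𝔪 := (f 1).2
  have hα : α ≠ 0 := by
    intro h
    exact f.ne_zero 0 (Subtype.ext (Subtype.ext h))
  have hβ : β ≠ 0 := by
    intro h
    exact f.ne_zero 1 (Subtype.ext (Subtype.ext h))
  have hσα : σ α ≠ 0 := by simpa using hα
  have hσβ : σ β ≠ 0 := by simpa using hβ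
  have hD : α * σ β - σ α * β ≠ 0 := by
    intro h
    -- `β / α` is rational
    obtain ⟨t, ht⟩ := aux_fixed_rat h2 σ hσ (β / α) (by
      rw [map_div₀, div_eq_div_iff hσα hα]; linear_combination h)
    have h3 : (t.den : K) * β = t.num * α := by
      have : β = (t : K) * α := by
        rw [eq_div_iff hα] at ht
        simpa using ht.symm
      rw [this, ← mul_assoc]
      congr 1
      have := Rat.den_mul_eq_num t
      exact_mod_cast congrArg (fun z : ℚ => (z : K)) this
    have h4 : (t.den : ℤ) • f 1 - t.num • f 0 = 0 := by
      apply Subtype.ext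
      apply Subtype.ext
      have : (t.den : K) * β - t.num * α = 0 := by rw [h3, sub_self]
      simpa using this
    have h5 := congrArg (fun z => f.repr z 1) h4
    simp at h5
  obtain ⟨A, hA⟩ := aux_int h2 σ hσ (α * σ α) (by rw [map_mul, hinvol, mul_comm])
    (by rw [hαdef, ← hσO]; exact (hIntegral _).mul (hIntegral _))
  obtain ⟨B, hB⟩ := aux_int h2 σ hσ (α * σ β + σ α * β)
    (by simp only [map_add, map_mul, hinvol]; ring)
    (by rw [hαdef, hβdef, ← hσO, ← hσO]
        exact ((hIntegral _).mul (hIntegral _)).add ((hIntegral _).mul (hIntegral _)))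
  obtain ⟨C, hC⟩ := aux_int h2 σ hσ (β * σ β) (by rw [map_mul, hinvol, mul_comm])
    (by rw [hβdef, ← hσO]; exact (hIntegral _).mul (hIntegral _))
  have hA0 : A ≠ 0 := by
    rintro rfl
    have : α * σ α ≠ 0 := mul_ne_zero hα hσα
    exact this (by rw [← hA]; simp)
  obtain ⟨g, A', B', C', u, v, w, hg, rfl, rfl, rfl, h1⟩ := aux_gcd A B C hA0
  push_cast at hA hB hC
  have hgK : (g : K) ≠ 0 := by exact_mod_cast hg
  have h1K : (u : K) * A' + v * B' + w * C' = 1 := by exact_mod_cast h1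
  -- multiplier ring
  have hmult : ∀ x : K, (∃ p q : ℤ, x * α = p * α + q * β) →
      (∃ p q : ℤ, x * β = p * α + q * β) → ∃ y : O, (y : K) = x := by
    rintro x ⟨p, q, hx1⟩ ⟨r, s, hx2⟩
    obtain ⟨I, hI⟩ := hinv
    have hle : FractionalIdeal.spanSingleton O⁰ x * (I : FractionalIdeal O⁰ K) ≤ I := by
      rw [FractionalIdeal.spanSingleton_mul_le_iff, hI]
      intro z hz
      obtain ⟨z, hz', rfl⟩ := (FractionalIdeal.mem_coeIdeal _).1 hz
      obtain ⟨m, n, hmn⟩ := hfcoord z hz'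
      rw [FractionalIdeal.mem_coeIdeal]
      refine ⟨(m * p + n * r : ℤ) • (f 0 : O) + (m * q + n * s : ℤ) • (f 1 : O),
        𝔪.add_mem (zsmul_mem hαm _) (zsmul_mem hβm _), ?_⟩
      change _ = x * (z : K)
      rw [hmn]
      change (((m * p + n * r : ℤ) • (f 0 : O) + (m * q + n * s : ℤ) • (f 1 : O) : O) : K) = _
      push_cast
      simp only [zsmul_eq_mul]
      push_cast
      linear_combination (-(m : K)) * hx1 - (n : K) * hx2
    have hle2 : FractionalIdeal.spanSingleton O⁰ x ≤ 1 := by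
      have := mul_le_mul_left hle ((I⁻¹ : (FractionalIdeal O⁰ K)ˣ) : FractionalIdeal O⁰ K)
      simpa [mul_assoc] using this
    rw [FractionalIdeal.spanSingleton_le_iff_mem, FractionalIdeal.mem_one_iff] at hle2
    exact hle2
  obtain ⟨θ, hθ⟩ := hmult (σ α * β / g)
    ⟨0, A', by field_simp; push_cast; linear_combination (-β) * hA⟩
    ⟨-C', B', by field_simp; push_cast; linear_combination (-β) * hB + α * hC⟩
  have hσθ : σ (θ : K) = α * σ β / g := by
    rw [hθ, map_div₀, map_mul, hinvol, hσint]
  -- `O = ℤ + ℤ θ`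
  have hO : ∀ x : O, ∃ p k : ℤ, (x : K) = p + k * (θ : K) := by
    intro x
    obtain ⟨p, q, hx1⟩ := hfcoord (x * (f 0 : O)) (𝔪.mul_mem_left x hαm)
    obtain ⟨r, s, hx2⟩ := hfcoord (x * (f 1 : O)) (𝔪.mul_mem_left x hβm)
    have hx1 : (x : K) * α = p * α + q * β := hx1
    have hx2 : (x : K) * β = r * α + s * β := hx2
    refine ⟨p, u * q + v * (s - p) - w * r, ?_⟩
    rw [hθ]
    push_cast
    refine aux_coord α β (σ α) (σ β) x (σ x) g A' B' C' u v w p q r s hσα hβ hgK hD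
      hA.symm hB.symm hC.symm h1K hx1 hx2 ?_ ?_
    · simpa [hσint] using congrArg σ hx1
    · simpa [hσint] using congrArg σ hx2
  -- discriminant comparison
  obtain ⟨p0, k0, he0⟩ := hO (e 0)
  obtain ⟨p1, k1, he1⟩ := hO (e 1)
  have hD1 : D0 = ((p0 * k1 - k0 * p1 : ℤ) : K) * (σ θ - θ) := by
    rw [hD0, he0, he1]
    simp only [map_add, map_mul, hσint]
    push_cast
    ring
  have hD2 : σ (θ : K) - θ = (e.det ![1, θ] : ℤ) * D0 := by
    have := hdet ![1, θ]
    simpa using this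
  have hD3 : α * σ β - σ α * β = (e.det (fun i => ((f i : 𝔪) : O)) : ℤ) * D0 :=
    hdet (fun i => ((f i : 𝔪) : O))
  have hD4 : α * σ β - σ α * β = g * (σ (θ : K) - θ) := by
    rw [hσθ, hθ]; field_simp
  have hθ0 : σ (θ : K) - θ ≠ 0 := by
    intro h; rw [h, mul_zero] at hD4; exact hD hD4
  have hunit : (e.det ![1, θ]) * (p0 * k1 - k0 * p1) = 1 := by
    have : (((e.det ![1, θ]) * (p0 * k1 - k0 * p1) : ℤ) : K) = 1 := by
      apply mul_right_cancel₀ hθ0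
      rw [one_mul]
      conv_rhs => rw [hD2, hD1]
      push_cast
      ring
    exact_mod_cast this
  have hgdet : g * (e.det ![1, θ]) = e.det (fun i => ((f i : 𝔪) : O)) := by
    have hD00 : D0 ≠ 0 := by
      intro h; rw [h, mul_zero] at hD2; exact hθ0 hD2
    have : ((g * (e.det ![1, θ]) : ℤ) : K) = (e.det (fun i => ((f i : 𝔪) : O)) : ℤ) := by
      apply mul_right_cancel₀ hD00
      rw [← hD3, hD4, hD2]
      push_cast
      ring
    exact_mod_cast this
  have hgabs : g.natAbs = Nat.card (O ⧸ 𝔪) := by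
    rw [← hcard, ← hgdet, Int.natAbs_mul, Int.natAbs_of_isUnit (IsUnit.of_mul_eq_one _ hunit),
      mul_one]
  have hspan : Ideal.span {(Nat.card (O ⧸ 𝔪) : O)} = Ideal.span {(g : O)} := by
    rw [← hgabs]
    rcases Int.natAbs_eq g with h | h
    · conv_rhs => rw [h]
      simp
    · conv_rhs => rw [h]
      rw [Int.cast_neg, Ideal.span_singleton_neg, Int.cast_natCast]
  rw [hspan]
  -- the ideal equality
  have hσα' : ((σO (f 0 : O) : O) : K) = σ α := hσO _
  have hσβ' : ((σO (f 1 : O) : O) : K) = σ β := hσO _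
  have hσθ' : ((σO θ : O) : K) = α * σ β / g := by rw [hσO, hσθ]
  have mem_map : ∀ x ∈ 𝔪, σO x ∈ Ideal.map σO 𝔪 := fun x hx => Ideal.mem_map_of_mem σO hx
  apply le_antisymm
  · rw [Ideal.mul_le]
    intro x hx y hy
    obtain ⟨y, hy', rfl⟩ := (Ideal.mem_map_iff_of_surjective σO σO.surjective).1 hy
    obtain ⟨p, q, hx⟩ := hfcoord x hx
    obtain ⟨r, s, hy⟩ := hfcoord y hy'
    rw [Ideal.mem_span_singleton]
    refine ⟨(p * r * A' + q * s * C' : ℤ) + (p * s : ℤ) * σO θ + (q * r : ℤ) * θ, ?_⟩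
    apply Subtype.ext
    push_cast
    rw [hσO, hσθ', hθ, hx, hy]
    simp only [map_add, map_mul, hσint]
    field_simp
    linear_combination (-(p : K) * r) * hA - (q : K) * s * hC
  · rw [Ideal.span_singleton_le_iff_mem]
    have : (g : O) = (u : O) * ((f 0 : O) * σO (f 0 : O))
        + (v : O) * ((f 0 : O) * σO (f 1 : O) + (f 1 : O) * σO (f 0 : O))
        + (w : O) * ((f 1 : O) * σO (f 1 : O)) := by
      apply Subtype.ext
      push_cast
      rw [hσα', hσβ', ← hαdef, ← hβdef]
      linear_combination (-(g : K)) * h1K + (u : K) * hA + (v : K) * hB + (w : K) * hC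
    rw [this]
    have m00 := Ideal.mul_mem_mul hαm (mem_map _ hαm)
    have m01 := Ideal.mul_mem_mul hαm (mem_map _ hβm)
    have m10 := Ideal.mul_mem_mul hβm (mem_map _ hαm)
    have m11 := Ideal.mul_mem_mul hβm (mem_map _ hβm)
    exact Ideal.add_mem _ (Ideal.add_mem _ (Ideal.mul_mem_left _ _ m00)
      (Ideal.mul_mem_left _ _ (Ideal.add_mem _ m01 m10))) (Ideal.mul_mem_left _ _ m11)
end
end
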